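/- Let n = 3, let h₀ > 0, and let k ≥ 1 be an integer. Then the supremum, over all functions h satisfying hypotheses (H) with h(0) = h₀, of σ_(k)(g_h) equals R λ_(k)/h₀² = R k(k+1)/h₀²; that is, σ_(k)(g_h) ≤ R λ_(k)/h₀² for every such h, and for every ε > 0 there exists h satisfying (H) with h(0) = h₀ and σ_(k)(g_h) > R λ_(k)/h₀² − ε. -/

import Mathlib

open MeasureTheory Set

/-- Hypotheses (H): `h` is smooth on `[0,R]`, positive on `[0,R)`, `h(R)=0`,
`h'(R) = -1`, and all even-order derivatives of `h` vanish at `R`. -/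
def SatisfiesH (R : ℝ) (h : ℝ → ℝ) : Prop :=
  ContDiffOn ℝ (⊤ : ℕ∞) h (Set.Icc 0 R) ∧
  (∀ r ∈ Set.Ico (0:ℝ) R, 0 < h r) ∧
  h R = 0 ∧
  derivWithin h (Set.Icc 0 R) R = -1 ∧
  ∀ k : ℕ, iteratedDerivWithin (2 * k) h (Set.Icc 0 R) R = 0

/-- The `k`-th distinct eigenvalue `λ_(k) = k (n + k - 2)` of the Laplacian on the
round unit sphere `S^{n-1}`. -/
noncomputable def sphereEig (n k : ℕ) : ℝ := (k : ℝ) * ((n : ℝ) + (k : ℝ) - 2)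

/-- The Rayleigh quotient
`R_λ(a; h) = (∫₀^R ((a')² h^{n-1} + λ a² h^{n-3}))/(a(0)² h(0)^{n-1})`. -/
noncomputable def rayleighQ (R : ℝ) (n : ℕ) (lam : ℝ) (h a : ℝ → ℝ) : ℝ :=
  (∫ r in (0:ℝ)..R,
      (deriv a r) ^ 2 * h r ^ ((n : ℤ) - 1) + lam * (a r) ^ 2 * h r ^ ((n : ℤ) - 3)) /
    ((a 0) ^ 2 * h 0 ^ ((n : ℤ) - 1))

/-- Admissible test functions: Lipschitz on `[0,R]`, vanishing at `R`, nonzero at `0`. -/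
def IsAdmissible (R : ℝ) (a : ℝ → ℝ) : Prop :=
  (∃ K : NNReal, LipschitzOnWith K a (Set.Icc 0 R)) ∧ a R = 0 ∧ a 0 ≠ 0

/-- The `k`-th distinct Steklov eigenvalue of the ball `[0,R] × S^{n-1}` with the
revolution metric `g_h`, characterized variationally. -/
noncomputable def steklov (R : ℝ) (n k : ℕ) (h : ℝ → ℝ) : ℝ :=
  sInf { v : ℝ | ∃ a : ℝ → ℝ, IsAdmissible R a ∧ v = rayleighQ R n (sphereEig n k) h a }

/-- `a` is a minimizer realizing `σ_(k)(g_h)`. -/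
def IsMinimizer (R : ℝ) (n k : ℕ) (h a : ℝ → ℝ) : Prop :=
  IsAdmissible R a ∧ rayleighQ R n (sphereEig n k) h a = steklov R n k h

open Filter Topology

lemma rayleighQ_three (R lam : ℝ) (h a : ℝ → ℝ) :
    rayleighQ R 3 lam h a =
      (∫ r in (0:ℝ)..R, (deriv a r) ^ 2 * h r ^ 2 + lam * (a r) ^ 2) / ((a 0) ^ 2 * h 0 ^ 2) := by
  have e1 : ((3 : ℕ) : ℤ) - 1 = ((2 : ℕ) : ℤ) := by norm_num
  have e2 : ((3 : ℕ) : ℤ) - 3 = 0 := by norm_num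
  unfold rayleighQ
  rw [e1, e2]
  simp only [zpow_natCast, zpow_zero, mul_one]

lemma energy_integrable {R lam : ℝ} (hR : 0 < R) {h a : ℝ → ℝ}
    (hh : ContinuousOn h (Icc 0 R)) {K : NNReal} (ha : LipschitzOnWith K a (Icc 0 R)) :
    IntervalIntegrable (fun r => (deriv a r) ^ 2 * h r ^ 2 + lam * (a r) ^ 2) volume 0 R := by
  have hd : IntervalIntegrable (fun r => (deriv a r) ^ 2) volume 0 R := by
    rw [intervalIntegrable_iff_integrableOn_Ioo_of_le hR.le]
    refine Measure.integrableOn_of_bounded (M := (K:ℝ)^2) (by simp)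
      ((measurable_deriv a).pow_const 2).aestronglyMeasurable ?_
    filter_upwards [ae_restrict_mem measurableSet_Ioo] with x hx
    have := norm_deriv_le_of_lipschitzOn (Icc_mem_nhds hx.1 hx.2) ha
    rw [norm_pow]
    gcongr
  have hu : uIcc 0 R = Icc 0 R := uIcc_of_le hR.le
  refine (hd.mul_continuousOn ?_).add ?_
  · rw [hu]; exact hh.pow 2
  · apply ContinuousOn.intervalIntegrable
    rw [hu]; exact continuousOn_const.mul (ha.continuousOn.pow 2)

lemma sphereEig_three (k : ℕ) : sphereEig 3 k = (k:ℝ) * ((k:ℝ) + 1) := by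
  unfold sphereEig; push_cast; ring

lemma sphereEig_nonneg (k : ℕ) : 0 ≤ sphereEig 3 k := by
  rw [sphereEig_three]; positivity

lemma steklov_bddBelow (R : ℝ) (hR : 0 < R) (k : ℕ) (h : ℝ → ℝ) :
    BddBelow { v : ℝ | ∃ a : ℝ → ℝ, IsAdmissible R a ∧
      v = rayleighQ R 3 (sphereEig 3 k) h a } := by
  refine ⟨0, ?_⟩
  rintro v ⟨a, -, rfl⟩
  rw [rayleighQ_three]
  have := sphereEig_nonneg k
  apply div_nonneg _ (by positivity)
  apply intervalIntegral.integral_nonneg hR.le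
  intro u _
  positivity

lemma cutoff_lipschitz (R δ : ℝ) (hδ : 0 < δ) :
    LipschitzWith (Real.toNNReal (1/δ)) (fun r : ℝ => min 1 ((R - r) / δ)) := by
  apply LipschitzWith.const_min
  apply LipschitzWith.of_dist_le_mul
  intro x y
  rw [Real.coe_toNNReal _ (by positivity), Real.dist_eq, Real.dist_eq]
  have : (R - x) / δ - (R - y) / δ = -((x - y) * (1/δ)) := by field_simp; ring
  rw [this, abs_neg, abs_mul, abs_of_pos (by positivity : 0 < 1/δ), mul_comm]

lemma upper_delta (R : ℝ) (hR : 0 < R) (k : ℕ) (h : ℝ → ℝ) (h0 : 0 < h 0)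
    (hRz : h R = 0) (C : NNReal) (hC : LipschitzOnWith C h (Icc 0 R))
    (δ : ℝ) (hδ : 0 < δ) (hδR : δ < R) :
    steklov R 3 k h ≤ (R * sphereEig 3 k + (C:ℝ)^2 * δ) / (h 0) ^ 2 := by
  set a : ℝ → ℝ := fun r : ℝ => min 1 ((R - r) / δ) with ha
  have hlip := cutoff_lipschitz R δ hδ
  have ha0 : a 0 = 1 := by
    simp only [ha, sub_zero]
    exact min_eq_left ((one_le_div hδ).2 hδR.le)
  have haR : a R = 0 := by simp [ha]
  have hadm : IsAdmissible R a := ⟨⟨_, hlip.lipschitzOnWith⟩, haR, by rw [ha0]; exact one_ne_zero⟩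
  have hl := sphereEig_nonneg k
  refine (csInf_le (steklov_bddBelow R hR k h) ⟨a, hadm, rfl⟩).trans ?_
  rw [rayleighQ_three, ha0, one_pow, one_mul]
  gcongr
  set lam := sphereEig 3 k
  have henergy := energy_integrable (lam := lam) hR hC.continuousOn
    (hlip.lipschitzOnWith (s := Icc 0 R))
  have hT : R - δ ∈ Icc 0 R := ⟨by linarith, by linarith⟩
  have hsub1 : uIcc 0 (R-δ) ⊆ uIcc 0 R := by
    rw [uIcc_of_le hT.1, uIcc_of_le hR.le]; exact Icc_subset_Icc_right hT.2
  have hsub2 : uIcc (R-δ) R ⊆ uIcc 0 R := by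
    rw [uIcc_of_le hT.2, uIcc_of_le hR.le]; exact Icc_subset_Icc_left hT.1
  have henergy1 := henergy.mono_set hsub1
  have henergy2 := henergy.mono_set hsub2
  have hsq : ∀ r ∈ Icc 0 R, a r ^ 2 ≤ 1 := by
    intro r hr
    have h1 : a r ≤ 1 := min_le_left _ _
    have h2 : 0 ≤ a r := le_min zero_le_one (div_nonneg (by linarith [hr.2]) hδ.le)
    nlinarith
  rw [← intervalIntegral.integral_add_adjacent_intervals henergy1 henergy2]
  have i1 : ∫ r in (0:ℝ)..(R-δ), (deriv a r) ^ 2 * h r ^ 2 + lam * (a r) ^ 2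
      ≤ ∫ r in (0:ℝ)..(R-δ), lam := by
    apply intervalIntegral.integral_mono_on_of_le_Ioo hT.1 henergy1 (by simp)
    intro r hr
    have hd : deriv a r = 0 := by
      have : a =ᶠ[𝓝 r] fun _ => (1:ℝ) := by
        filter_upwards [Iio_mem_nhds hr.2] with x hx
        have hx : x < R - δ := hx
        exact min_eq_left ((one_le_div hδ).2 (by linarith))
      rw [this.deriv_eq]; simp
    have := hsq r ⟨hr.1.le, hr.2.le.trans hT.2⟩
    rw [hd]
    nlinarith
  have i2 : ∫ r in (R-δ)..R, (deriv a r) ^ 2 * h r ^ 2 + lam * (a r) ^ 2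
      ≤ ∫ r in (R-δ)..R, ((C:ℝ)^2 + lam) := by
    apply intervalIntegral.integral_mono_on_of_le_Ioo hT.2 henergy2 (by simp)
    intro r hr
    have hrR : r ∈ Icc 0 R := ⟨hT.1.trans hr.1.le, hr.2.le⟩
    have h1 := hsq r hrR
    have h2 : |deriv a r| ≤ 1/δ := by
      have := norm_deriv_le_of_lipschitz (x₀ := r) hlip
      rwa [Real.coe_toNNReal _ (by positivity), Real.norm_eq_abs] at this
    have h3 : |h r| ≤ C * δ := by
      have := hC.dist_le_mul r hrR R ⟨hR.le, le_rfl⟩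
      rw [Real.dist_eq, Real.dist_eq, hRz, sub_zero, abs_sub_comm r R,
        abs_of_pos (by linarith [hr.2] : 0 < R - r)]
        at this
      refine this.trans ?_
      gcongr
      linarith [hr.1]
    have h4 : |deriv a r * h r| ≤ C := by
      rw [abs_mul]
      calc _ ≤ 1/δ * (C*δ) := by gcongr
        _ = C := by field_simp
    have h5 : (deriv a r) ^ 2 * h r ^ 2 ≤ (C:ℝ)^2 := by
      rw [← mul_pow]; exact sq_le_sq' (by linarith [abs_le.1 h4]) (abs_le.1 h4).2
    nlinarith
  simp only [intervalIntegral.integral_const, smul_eq_mul] at i1 i2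
  nlinarith

lemma upper (R : ℝ) (hR : 0 < R) (k : ℕ) (h : ℝ → ℝ) (H : SatisfiesH R h) (h0 : 0 < h 0) :
    steklov R 3 k h ≤ R * sphereEig 3 k / (h 0) ^ 2 := by
  obtain ⟨hs, -, hRz, -, -⟩ := H
  obtain ⟨C, hC⟩ := hs.exists_lipschitzOnWith (by simp) (convex_Icc _ _) isCompact_Icc
  have key : ∀ᶠ δ in 𝓝[>] (0:ℝ),
      steklov R 3 k h ≤ (R * sphereEig 3 k + (C:ℝ)^2 * δ) / (h 0) ^ 2 := by
    filter_upwards [Ioo_mem_nhdsGT hR] with δ hδ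
    exact upper_delta R hR k h h0 hRz C hC δ hδ.1 hδ.2
  have lim : Tendsto (fun δ : ℝ => (R * sphereEig 3 k + (C:ℝ)^2 * δ) / (h 0) ^ 2) (𝓝[>] 0)
      (𝓝 (R * sphereEig 3 k / (h 0) ^ 2)) := by
    have : Continuous (fun δ : ℝ => (R * sphereEig 3 k + (C:ℝ)^2 * δ) / (h 0) ^ 2) := by fun_prop
    have := this.tendsto 0
    simp only [mul_zero, add_zero] at this
    exact this.mono_left nhdsWithin_le_nhds
  exact ge_of_tendsto lim key

/-- Calibration (Riccati) lower bound. -/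
lemma calibration {R T lam : ℝ} (hR : 0 < R) (hT : T ∈ Icc 0 R) (hlam : 0 ≤ lam)
    {h a p p' : ℝ → ℝ} (hh : ContinuousOn h (Icc 0 R)) {K : NNReal}
    (ha : LipschitzOnWith K a (Icc 0 R)) (hpc : ContDiffOn ℝ 1 p (Icc 0 T))
    (hp : ∀ r ∈ Ioo 0 T, HasDerivAt p (p' r) r) (hpos : ∀ r ∈ Ioo 0 T, 0 < h r)
    (hric : ∀ r ∈ Ioo 0 T, p r ^ 2 ≤ (p' r + lam) * h r ^ 2) (hpT : p T ≤ 0) :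
    p 0 * a 0 ^ 2 ≤ ∫ r in (0:ℝ)..R, (deriv a r) ^ 2 * h r ^ 2 + lam * (a r) ^ 2 := by
  have henergy := energy_integrable (lam := lam) hR hh ha
  have hsub0 : Icc 0 T ⊆ Icc 0 R := Icc_subset_Icc_right hT.2
  have hsub1 : uIcc 0 T ⊆ uIcc 0 R := by
    rwa [uIcc_of_le hT.1, uIcc_of_le hR.le]
  have hsub2 : uIcc T R ⊆ uIcc 0 R := by
    rw [uIcc_of_le hT.2, uIcc_of_le hR.le]; exact Icc_subset_Icc_left hT.1
  have henergy1 := henergy.mono_set hsub1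
  have henergy2 := henergy.mono_set hsub2
  rw [← intervalIntegral.integral_add_adjacent_intervals henergy1 henergy2]
  have i2 : 0 ≤ ∫ r in T..R, (deriv a r) ^ 2 * h r ^ 2 + lam * (a r) ^ 2 := by
    apply intervalIntegral.integral_nonneg hT.2
    intro u _
    positivity
  have haT : AbsolutelyContinuousOnInterval a 0 T := by
    apply LipschitzOnWith.absolutelyContinuousOnInterval (K := K)
    rw [uIcc_of_le hT.1]; exact ha.mono hsub0
  have hpT' : AbsolutelyContinuousOnInterval p 0 T := by
    apply ContDiffOn.absolutelyContinuousOnInterval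
    rwa [uIcc_of_le hT.1]
  have hf := hpT'.mul (haT.mul haT)
  have ftc := hf.integral_deriv_eq_sub
  have hfi := hf.intervalIntegrable_deriv
  have i1 : ∫ r in (0:ℝ)..T, -(deriv (p * (a * a)) r) ≤
      ∫ r in (0:ℝ)..T, (deriv a r) ^ 2 * h r ^ 2 + lam * (a r) ^ 2 := by
    apply intervalIntegral.integral_mono_ae_restrict hT.1 hfi.neg henergy1
    rw [Measure.restrict_congr_set Ioo_ae_eq_Icc.symm]
    filter_upwards [ae_restrict_mem measurableSet_Ioo, ae_restrict_of_ae haT.ae_differentiableAt]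
      with r hr hdiff
    have hda := (hdiff (by rw [uIcc_of_le hT.1]; exact ⟨hr.1.le, hr.2.le⟩)).hasDerivAt
    have hd := ((hp r hr).mul (hda.mul hda)).deriv
    rw [Pi.neg_apply, hd]
    have hr1 := hric r hr
    have hr2 := hpos r hr
    simp only [Pi.mul_apply]
    set d := deriv a r
    have hh2 : 0 < h r ^ 2 := by positivity
    have : 0 ≤ h r ^ 2 * (d ^ 2 * h r ^ 2 + lam * a r ^ 2 +
        (p' r * (a r * a r) + p r * (d * a r + a r * d))) := by
      have e : h r ^ 2 * (d ^ 2 * h r ^ 2 + lam * a r ^ 2 +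
        (p' r * (a r * a r) + p r * (d * a r + a r * d))) =
        (d * h r ^ 2 + p r * a r) ^ 2 + ((p' r + lam) * h r ^ 2 - p r ^ 2) * a r ^ 2 := by ring
      rw [e]
      have := mul_nonneg (sub_nonneg.2 hr1) (sq_nonneg (a r))
      positivity
    have := nonneg_of_mul_nonneg_right this hh2
    linarith
  rw [intervalIntegral.integral_neg, ftc] at i1
  simp only [Pi.mul_apply] at i1
  nlinarith [mul_nonneg (neg_nonneg.2 hpT) (sq_nonneg (a T))]

/-- The profile. -/
noncomputable def prof (R c M : ℝ) (r : ℝ) : ℝ :=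
  (R - r) * (1 + c * (R - r) ^ 2 + M * ((R - r) ^ 2 * (R ^ 2 - (R - r) ^ 2)))

lemma prof_contDiff (R c M : ℝ) : ContDiff ℝ (⊤ : ℕ∞) (prof R c M) := by
  unfold prof; fun_prop

lemma prof_even (R c M : ℝ) (k : ℕ) : iteratedDeriv (2 * k) (prof R c M) R = 0 := by
  set f : ℝ → ℝ := fun x => prof R c M (x + R) with hf
  have h1 : iteratedDeriv (2*k) f 0 = iteratedDeriv (2*k) (prof R c M) R := by
    rw [hf, iteratedDeriv_comp_add_const]; simp
  have h2 := iteratedDeriv_comp_neg (2*k) f 0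
  have h3 : (fun x => f (-x)) = fun x => -f x := by
    funext x; simp only [hf, prof]; ring
  rw [h3, iteratedDeriv_fun_neg] at h2
  simp at h2
  rw [← h1]; linarith

lemma prof_hasDeriv (R c M : ℝ) : HasDerivAt (prof R c M) (-1) R := by
  have h1 : HasDerivAt (fun r : ℝ => R - r) (-1) R := by
    simpa using (hasDerivAt_id R).const_sub R
  have h2 : DifferentiableAt ℝ (fun r : ℝ => 1 + c * (R - r) ^ 2 +
    M * ((R - r) ^ 2 * (R ^ 2 - (R - r) ^ 2))) R := by fun_prop
  have := h1.mul h2.hasDerivAt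
  unfold prof
  convert! this using 1
  simp

/-- Lower bound for the profile factor. -/
lemma factor_lower {R h0 m : ℝ} (hR : 0 < R) (hm1 : m ≤ 1) (hm2 : m ≤ h0 / R)
    {s : ℝ} (hs0 : 0 ≤ s) (hsR : s ≤ R) :
    m ≤ 1 + (h0 / R - 1) / R ^ 2 * s ^ 2 := by
  have ht : s ^ 2 / R ^ 2 ≤ 1 := by
    rw [div_le_one (by positivity)]; gcongr
  have ht0 : 0 ≤ s ^ 2 / R ^ 2 := by positivity
  have e : (h0 / R - 1) / R ^ 2 * s ^ 2 = (h0 / R - 1) * (s ^ 2 / R ^ 2) := by ring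
  rw [e]
  nlinarith [mul_nonneg (sub_nonneg.2 ht) (sub_nonneg.2 hm1), mul_nonneg ht0 (sub_nonneg.2 hm2)]

lemma prof_satisfies {R h0 M : ℝ} (hR : 0 < R) (hh0 : 0 < h0) (hM : 0 ≤ M) :
    SatisfiesH R (prof R ((h0 / R - 1) / R ^ 2) M) := by
  have hu : UniqueDiffOn ℝ (Icc 0 R) := uniqueDiffOn_Icc hR
  have hRm : R ∈ Icc 0 R := ⟨hR.le, le_rfl⟩
  refine ⟨(prof_contDiff _ _ _).contDiffOn, ?_, by simp [prof], ?_, ?_⟩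
  · intro r hr
    have hs : 0 < R - r := by linarith [hr.2]
    have hsR : R - r ≤ R := by linarith [hr.1]
    have hmpos : 0 < min 1 (h0 / R) := lt_min one_pos (by positivity)
    have h1 := factor_lower hR (min_le_left _ _) (min_le_right 1 (h0/R)) hs.le hsR
    have h2 : 0 ≤ R ^ 2 - (R - r) ^ 2 := by nlinarith
    have h3 : 0 ≤ M * ((R - r) ^ 2 * (R ^ 2 - (R - r) ^ 2)) := by positivity
    exact mul_pos hs (by linarith)
  · exact (prof_hasDeriv _ _ _).hasDerivWithinAt.derivWithin (hu R hRm)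
  · intro k
    rw [iteratedDerivWithin_eq_iteratedDeriv hu _ hRm]
    · exact prof_even _ _ _ k
    · exact ((prof_contDiff _ _ _).of_le (WithTop.coe_le_coe.2 le_top)).contDiffAt

lemma lower_main {R h0 δ η m : ℝ} (hR : 0 < R) (hh0 : 0 < h0) (k : ℕ) (hk : 1 ≤ k)
    (hδ : 0 < δ) (hδR : δ < R) (hη : 0 < η) (hηl : η ≤ R * sphereEig 3 k)
    (hm : m = min 1 (h0 / R)) :
    ∃ h : ℝ → ℝ, SatisfiesH R h ∧ h 0 = h0 ∧
      (sphereEig 3 k * (R - δ) - η) / h0 ^ 2 ≤ steklov R 3 k h := by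
  set lam := sphereEig 3 k with hlamdef
  have hlam : 0 < lam := by
    rw [hlamdef, sphereEig_three]
    have : (1:ℝ) ≤ k := by exact_mod_cast hk
    positivity
  have hmpos : 0 < m := by rw [hm]; exact lt_min one_pos (by positivity)
  set B : ℝ := (lam * R) ^ 2 / (δ ^ 2 * (η * m)) with hB
  have hBpos : 0 < B := by positivity
  set M : ℝ := B / (δ ^ 2 * R) with hM
  have hMpos : 0 < M := by positivity
  set h := prof R ((h0 / R - 1) / R ^ 2) M with hh
  have hzero : h 0 = h0 := by simp only [hh, prof]; field_simp; ring
  refine ⟨h, prof_satisfies hR hh0 hMpos.le, hzero, ?_⟩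
  have hT : R - δ ∈ Icc 0 R := ⟨by linarith, by linarith⟩
  have hlow : ∀ r ∈ Ioo 0 (R - δ), δ * (m + B * r) ≤ h r := by
    intro r hr
    have hs : δ ≤ R - r := by linarith [hr.2]
    have hsR : R - r ≤ R := by linarith [hr.1]
    have h1 := factor_lower hR (hm ▸ min_le_left _ _ : m ≤ 1) (hm ▸ min_le_right _ _ : m ≤ h0 / R)
      (by linarith : 0 ≤ R - r) hsR
    have h2 : R * r ≤ R ^ 2 - (R - r) ^ 2 := by nlinarith [hr.1]
    have h3 : B * r ≤ M * ((R - r) ^ 2 * (R ^ 2 - (R - r) ^ 2)) := by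
      have : B * r = M * (δ ^ 2 * (R * r)) := by rw [hM]; field_simp
      rw [this]
      have := hr.1
      gcongr
    have h4 : 0 ≤ m + B * r := by have := hr.1; positivity
    have h5 : 0 ≤ R - r := by linarith
    simp only [hh, prof]
    apply mul_le_mul hs (by linarith) h4 h5
  set p : ℝ → ℝ := fun r => lam * (R - δ - r) - η * m / (m + B * r) with hp
  set p' : ℝ → ℝ := fun r => -lam + η * m * B / (m + B * r) ^ 2 with hp'
  have hden : ∀ r, 0 ≤ r → 0 < m + B * r := fun r hr => by positivity
  apply le_csInf
  · refine ⟨_, fun r : ℝ => min 1 ((R - r) / δ),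
      ⟨⟨_, (cutoff_lipschitz R δ hδ).lipschitzOnWith⟩, by simp, ?_⟩, rfl⟩
    have : (0:ℝ) < min 1 ((R - 0) / δ) := lt_min one_pos (by rw [sub_zero]; positivity)
    exact this.ne'
  rintro v ⟨a, ⟨⟨K, haL⟩, haR, ha0⟩, rfl⟩
  rw [rayleighQ_three, hzero]
  have ha2 : 0 < a 0 ^ 2 := by positivity
  have main : p 0 * a 0 ^ 2 ≤ ∫ r in (0:ℝ)..R, (deriv a r) ^ 2 * h r ^ 2 + lam * (a r) ^ 2 := by
    apply calibration (p' := p') hR hT hlam.le (prof_contDiff _ _ _).continuous.continuousOn haL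
    · apply ContDiffOn.sub
      · fun_prop
      · apply ContDiffOn.div (by fun_prop) (by fun_prop)
        intro r hr
        exact (hden r hr.1).ne'
    · intro r hr
      have hd := hden r hr.1.le
      have h1 : HasDerivAt (fun r : ℝ => m + B * r) B r := by
        simpa using ((hasDerivAt_id r).const_mul B).const_add m
      have h2 := (hasDerivAt_const r (η * m)).div h1 hd.ne'
      have h3 : HasDerivAt (fun r : ℝ => lam * (R - δ - r)) (-lam) r := by
        simpa using ((hasDerivAt_id r).const_sub (R - δ)).const_mul lam
      have := h3.sub h2
      convert! this using 1
      simp only [hp']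
      ring
    · intro r hr
      have := hden r hr.1.le
      exact lt_of_lt_of_le (by positivity) (hlow r hr)
    · intro r hr
      have hd := hden r hr.1.le
      have hq0 : 0 ≤ η * m / (m + B * r) := by positivity
      have hq1 : η * m / (m + B * r) ≤ η := by
        rw [div_le_iff₀ hd]
        have := hr.1
        have : 0 ≤ B * r := by positivity
        nlinarith
      have hpsq : p r ^ 2 ≤ (lam * R) ^ 2 := by
        have h6 : 0 ≤ lam * (R - δ - r) := mul_nonneg hlam.le (by linarith [hr.2])
        have h7 : lam * (R - δ - r) ≤ lam * R :=
          mul_le_mul_of_nonneg_left (by linarith [hr.1]) hlam.le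
        apply sq_le_sq'
        · simp only [hp]; linarith
        · simp only [hp]; linarith
      refine hpsq.trans ?_
      have e : (lam * R) ^ 2 = (p' r + lam) * (δ * (m + B * r)) ^ 2 := by
        have : η * m * B * δ ^ 2 = (lam * R) ^ 2 := by rw [hB]; field_simp
        rw [← this]
        simp only [hp']
        field_simp
        ring
      rw [e]
      have h8 : 0 ≤ p' r + lam := by
        simp only [hp']
        have : 0 ≤ η * m * B / (m + B * r) ^ 2 := by positivity
        linarith
      have := hlow r hr
      gcongr
    · have := hden (R - δ) hT.1
      have : 0 ≤ η * m / (m + B * (R - δ)) := by positivity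
      simp only [hp, sub_self, mul_zero]
      linarith
  have hp0 : p 0 = lam * (R - δ) - η := by
    simp only [hp, sub_zero, mul_zero, add_zero]; field_simp
  rw [hp0] at main
  rw [div_le_div_iff₀ (by positivity) (by positivity)]
  nlinarith [mul_le_mul_of_nonneg_right main (sq_nonneg h0)]

theorem stmt_5 (R : ℝ) (hR : 0 < R) (h0 : ℝ) (hh0 : 0 < h0) (k : ℕ) (hk : 1 ≤ k) :
    (∀ h : ℝ → ℝ, SatisfiesH R h → h 0 = h0 →
      steklov R 3 k h ≤ R * sphereEig 3 k / h0 ^ 2) ∧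
    (∀ ε : ℝ, 0 < ε → ∃ h : ℝ → ℝ, SatisfiesH R h ∧ h 0 = h0 ∧
      steklov R 3 k h > R * sphereEig 3 k / h0 ^ 2 - ε) ∧
    R * sphereEig 3 k / h0 ^ 2 = R * ((k : ℝ) * ((k : ℝ) + 1)) / h0 ^ 2 := by
  refine ⟨?_, ?_, by rw [sphereEig_three]⟩
  · rintro h H rfl
    exact upper R hR k h H hh0
  · intro ε hε
    have hlam : 0 < sphereEig 3 k := by
      rw [sphereEig_three]
      have : (1:ℝ) ≤ k := by exact_mod_cast hk
      positivity
    set lam := sphereEig 3 k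
    have hE : 0 < ε * h0 ^ 2 / 3 := by positivity
    set δ := min (R / 2) (ε * h0 ^ 2 / 3 / lam) with hδ
    set η := min (R * lam) (ε * h0 ^ 2 / 3) with hη
    have hδ0 : 0 < δ := lt_min (by positivity) (by positivity)
    have hδR : δ < R := (min_le_left _ _).trans_lt (by linarith)
    have hη0 : 0 < η := lt_min (by positivity) hE
    obtain ⟨h, H, hz, hb⟩ := lower_main hR hh0 k hk hδ0 hδR hη0 (min_le_left _ _) rfl
    refine ⟨h, H, hz, lt_of_lt_of_le ?_ hb⟩
    have h1 : lam * δ ≤ ε * h0 ^ 2 / 3 := by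
      have : δ ≤ ε * h0 ^ 2 / 3 / lam := min_le_right _ _
      rw [le_div_iff₀ hlam] at this
      linarith
    have h2 : η ≤ ε * h0 ^ 2 / 3 := min_le_right _ _
    rw [sub_lt_iff_lt_add, ← sub_lt_iff_lt_add', ← sub_div, div_lt_iff₀ (by positivity)]
    change R * lam - (lam * (R - δ) - η) < _
    nlinarith
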